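/- arXiv:2205.11054 — 2 statements merged into one kernel-verified Lean document; each statement's English description precedes it below -/
import Mathlib

section
/- Let (T, F) be a pretorsion theory in a category C admitting pullbacks along monomorphisms. Then T is closed under subobjects (if n : X → Y is a monomorphism and Y ∈ T then X ∈ T) if and only if for every monomorphism n : X → Y the commutative square with top edge ε_X : T(X) → X, bottom edge ε_Y : T(Y) → Y, left edge T(n) : T(X) → T(Y) and right edge n : X → Y is a pullback. -/
/- Basic notions of pretorsion theories, after Borceux, Campanini, Gran,
"Pretorsion theories in lextensive categories". -/

namespace PretorsionPaper

open CategoryTheory CategoryTheory.Limits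

universe w₂ w₁ v' u' v u

variable {C : Type u} [Category.{v} C]

/-- A morphism is `Z`-trivial if it factors through an object of `Z`. -/
def IsTrivial (Z : Set C) {X Y : C} (f : X ⟶ Y) : Prop :=
  ∃ (W : C) (g : X ⟶ W) (h : W ⟶ Y), W ∈ Z ∧ g ≫ h = f

/-- `ε : K ⟶ A` is a `Z`-kernel of `f : A ⟶ B`. -/
structure IsZKernel (Z : Set C) {K A B : C} (ε : K ⟶ A) (f : A ⟶ B) : Prop where
  comp_trivial : IsTrivial Z (ε ≫ f)
  lift : ∀ {Y : C} (l : Y ⟶ A), IsTrivial Z (l ≫ f) → ∃! l' : Y ⟶ K, l' ≫ ε = l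

/-- `q : B ⟶ Q` is a `Z`-cokernel of `f : A ⟶ B`. -/
structure IsZCokernel (Z : Set C) {A B Q : C} (q : B ⟶ Q) (f : A ⟶ B) : Prop where
  comp_trivial : IsTrivial Z (f ≫ q)
  desc : ∀ {W : C} (h : B ⟶ W), IsTrivial Z (f ≫ h) → ∃! h' : Q ⟶ W, q ≫ h' = h

/-- A pretorsion theory `(T, F)` in a category `C`: two replete full subcategories
(given by their classes of objects) such that every morphism from `T` to `F` is
`Z`-trivial (`Z := T ∩ F`) and every object fits in a short `Z`-exact sequence
`T₀ ⟶ X ⟶ F₀` with `T₀ ∈ T`, `F₀ ∈ F`. -/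
structure PretorsionTheory (C : Type u) [Category.{v} C] where
  T : Set C
  F : Set C
  replete_T : ∀ {X Y : C}, (X ≅ Y) → X ∈ T → Y ∈ T
  replete_F : ∀ {X Y : C}, (X ≅ Y) → X ∈ F → Y ∈ F
  hom_trivial : ∀ {X Y : C}, X ∈ T → Y ∈ F → ∀ f : X ⟶ Y, IsTrivial (T ∩ F) f
  exact_seq : ∀ X : C, ∃ (T₀ F₀ : C) (e : T₀ ⟶ X) (h : X ⟶ F₀),
    T₀ ∈ T ∧ F₀ ∈ F ∧ IsZKernel (T ∩ F) e h ∧ IsZCokernel (T ∩ F) h e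

/-- The class of trivial objects of a pretorsion theory. -/
def PretorsionTheory.Z (P : PretorsionTheory C) : Set C := P.T ∩ P.F

theorem IsTrivial.precomp {Z : Set C} {W X Y : C} (a : W ⟶ X) {f : X ⟶ Y}
    (hf : IsTrivial Z f) : IsTrivial Z (a ≫ f) := by
  obtain ⟨V, g, h, hV, rfl⟩ := hf
  exact ⟨V, a ≫ g, h, hV, Category.assoc _ _ _⟩

theorem IsZKernel.mono {Z : Set C} {K A B : C} {ε : K ⟶ A} {f : A ⟶ B}
    (hε : IsZKernel Z ε f) : Mono ε where
  right_cancellation a b hab := by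
    have h : IsTrivial Z ((b ≫ ε) ≫ f) := by
      rw [Category.assoc]
      exact hε.comp_trivial.precomp b
    exact (hε.lift (b ≫ ε) h).unique hab rfl

/-- Morphisms from a torsion object lift along a `Z`-kernel of a morphism into a
torsion-free object. -/
theorem PretorsionTheory.exists_lift (P : PretorsionTheory C) {K A B W : C} {ε : K ⟶ A}
    {f : A ⟶ B} (hε : IsZKernel P.Z ε f) (hB : B ∈ P.F) (hW : W ∈ P.T) (g : W ⟶ A) :
    ∃ l : W ⟶ K, l ≫ ε = g :=
  (hε.lift g (P.hom_trivial hW hB (g ≫ f))).exists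

/-- suppose `C` admits pullbacks along monomorphisms, and fix, for every
object `X`, a canonical short `Z`-exact sequence `tObj X ⟶ X ⟶ fObj X` (with counit
`ε` and unit `η`).  Then `T` is closed under subobjects if and only if for every
monomorphism `n : X ⟶ Y` the square with top edge `ε X`, left edge the induced
morphism `Tn : tObj X ⟶ tObj Y`, right edge `n` and bottom edge `ε Y` is a pullback. -/
theorem torsion_closed_subobjects_iff_counit_square_pullback (P : PretorsionTheory C)
    (hpb : ∀ {X Y W : C} (f : X ⟶ W) (m : Y ⟶ W), Mono m → HasPullback f m)
    (tObj fObj : C → C) (ε : ∀ X : C, tObj X ⟶ X) (η : ∀ X : C, X ⟶ fObj X)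
    (htT : ∀ X : C, tObj X ∈ P.T) (hfF : ∀ X : C, fObj X ∈ P.F)
    (hker : ∀ X : C, IsZKernel P.Z (ε X) (η X))
    (hcoker : ∀ X : C, IsZCokernel P.Z (η X) (ε X)) :
    (∀ {X Y : C} (n : X ⟶ Y), Mono n → Y ∈ P.T → X ∈ P.T) ↔
    (∀ {X Y : C} (n : X ⟶ Y), Mono n → ∀ Tn : tObj X ⟶ tObj Y,
      Tn ≫ ε Y = ε X ≫ n → IsPullback (ε X) Tn n (ε Y)) := by
  have hmono : ∀ X : C, Mono (ε X) := fun X => (hker X).mono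
  constructor
  · intro hT X Y n hn Tn hTn
    have := hmono X
    have := hmono Y
    have := hpb (ε Y) n hn
    have hP : pullback (ε Y) n ∈ P.T :=
      hT (pullback.fst (ε Y) n) inferInstance (htT Y)
    obtain ⟨l, hl⟩ := P.exists_lift (hker X) (hfF X) hP (pullback.snd (ε Y) n)
    refine ⟨⟨hTn.symm⟩, ⟨PullbackCone.IsLimit.mk _
      (fun s => pullback.lift s.snd s.fst s.condition.symm ≫ l) ?_ ?_ ?_⟩⟩
    · intro s
      rw [Category.assoc, hl, pullback.lift_snd]
    · intro s
      rw [← cancel_mono (ε Y), Category.assoc, hTn, Category.assoc, reassoc_of% hl,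
        pullback.lift_snd_assoc, s.condition]
    · intro s m hm _
      rw [← cancel_mono (ε X), hm]
      rw [Category.assoc, hl, pullback.lift_snd]
  · intro h X Y n hn hY
    have := hmono Y
    obtain ⟨s, hs⟩ := P.exists_lift (hker Y) (hfF Y) hY (𝟙 Y)
    have : IsSplitEpi (ε Y) := ⟨⟨⟨s, hs⟩⟩⟩
    have : IsIso (ε Y) := isIso_of_mono_of_isSplitEpi _
    obtain ⟨Tn, hTn⟩ := P.exists_lift (hker Y) (hfF Y) (htT X) (ε X ≫ n)
    have : IsIso (ε X) := (h n hn Tn hTn).isIso_fst_of_isIso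
    exact P.replete_T (asIso (ε X)) (htT X)
end PretorsionPaper
end

section
/- Let (T, F) be a pretorsion theory in a lextensive category C. If a composite k∘g is Z-trivial and k is a Z-kernel (of some morphism), then g is Z-trivial. Consequently, the ideal of Z-trivial morphisms is stable under pullbacks along Z-kernels: in every pullback square with bottom edge a Z-kernel k : B → Y and right edge g : X → Y, if g is Z-trivial then the pulled-back morphism W → B is Z-trivial. -/
/- Basic notions of pretorsion theories, after Borceux, Campanini, Gran,
"Pretorsion theories in lextensive categories". -/

namespace PretorsionPaper

open CategoryTheory CategoryTheory.Limits

universe w₂ w₁ v' u' v u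

variable {C : Type u} [Category.{v} C]

variable {Z : Set C}

theorem IsTrivial.of_mem {V X : C} (hV : V ∈ Z) (f : V ⟶ X) : IsTrivial Z f :=
  ⟨V, 𝟙 V, f, hV, Category.id_comp f⟩

theorem IsTrivial.precomp_s11 {X Y Y' : C} (f : X ⟶ Y) {g : Y ⟶ Y'} (hg : IsTrivial Z g) :
    IsTrivial Z (f ≫ g) := by
  obtain ⟨V, a, b, hV, rfl⟩ := hg
  exact ⟨V, f ≫ a, b, hV, Category.assoc f a b⟩

theorem IsZKernel.mono_s11 {B Y Y' : C} {k : B ⟶ Y} {f : Y ⟶ Y'} (hk : IsZKernel Z k f) :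
    Mono k where
  right_cancellation g h e := by
    have hg : IsTrivial Z ((g ≫ k) ≫ f) := by
      rw [Category.assoc]
      exact hk.comp_trivial.precomp_s11 g
    exact (hk.lift _ hg).unique rfl e.symm

theorem IsZKernel.isTrivial_of_comp {W B Y Y' : C} {g : W ⟶ B} {k : B ⟶ Y} {f : Y ⟶ Y'}
    (hk : IsZKernel Z k f) (hgk : IsTrivial Z (g ≫ k)) : IsTrivial Z g := by
  obtain ⟨V, a, b, hV, hab⟩ := hgk
  obtain ⟨b', hb', -⟩ := hk.lift b (.of_mem hV _)
  have := hk.mono_s11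
  exact ⟨V, a, b', hV, by rw [← cancel_mono k, Category.assoc, hb', hab]⟩

/-- if `g ≫ k` is `Z`-trivial and `k` is a `Z`-kernel (of some morphism),
then `g` is `Z`-trivial; consequently the ideal of `Z`-trivial morphisms is stable under
pullbacks along `Z`-kernels. -/
theorem trivial_cancel_zkernel_and_pullback_stability
    [FinitaryExtensive C] [HasFiniteLimits C] (P : PretorsionTheory C) :
    (∀ {W B Y Y' : C} (g : W ⟶ B) (k : B ⟶ Y) (f : Y ⟶ Y'),
      IsZKernel P.Z k f → IsTrivial P.Z (g ≫ k) → IsTrivial P.Z g) ∧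
    (∀ {W B X Y Y' : C} (tk : W ⟶ X) (tg : W ⟶ B) (g : X ⟶ Y) (k : B ⟶ Y) (f : Y ⟶ Y'),
      IsZKernel P.Z k f → IsPullback tk tg g k → IsTrivial P.Z g → IsTrivial P.Z tg) := by
  refine ⟨fun _ _ _ hk => hk.isTrivial_of_comp, fun tk _ _ _ _ hk hpb hg => ?_⟩
  apply hk.isTrivial_of_comp
  rw [← hpb.w]
  exact hg.precomp_s11 tk

end PretorsionPaper
end
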